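/- arXiv:math/0102018 — 3 statements merged into one kernel-verified Lean document; each statement's English description precedes it below -/
import Mathlib

section
/- Let n ≥ 3 and let 𝒢(x) := 1/((n−2)σ_n) · |x|^{2−n}, where σ_n = 2π^{n/2}/Γ(n/2) is the surface measure of the unit sphere in ℝⁿ. Then 𝒢 is locally integrable on ℝⁿ and is a fundamental solution of −Δ: for every smooth compactly supported function φ : ℝⁿ → ℂ one has −∫_{ℝⁿ} 𝒢(x) Δφ(x) dx = φ(0). -/
open Complex Filter Topology MeasureTheory
open scoped ENNReal

noncomputable section

namespace SingPert

/-- The Laplacian `Δφ = ∑ i ∂²φ/∂xᵢ²` of a function on `ℝⁿ`. -/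
def laplacian {n : ℕ} (φ : EuclideanSpace ℝ (Fin n) → ℂ)
    (x : EuclideanSpace ℝ (Fin n)) : ℂ :=
  ∑ i : Fin n,
    fderiv ℝ (fun y => fderiv ℝ φ y (EuclideanSpace.single i (1 : ℝ))) x
      (EuclideanSpace.single i (1 : ℝ))

/-- The surface measure `σ_n = 2 π^(n/2) / Γ(n/2)` of the unit sphere `S^{n-1} ⊆ ℝⁿ`. -/
def sphereMeasure (n : ℕ) : ℝ :=
  2 * Real.pi ^ ((n : ℝ) / 2) / Real.Gamma ((n : ℝ) / 2)

/-- The Green function `𝒢(x) = |x|^{2-n} / ((n-2) σ_n)` of `-Δ` on `ℝⁿ`. -/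
def greenFn (n : ℕ) (x : EuclideanSpace ℝ (Fin n)) : ℝ :=
  (1 / (((n : ℝ) - 2) * sphereMeasure n)) * ‖x‖ ^ ((2 : ℝ) - (n : ℝ))

lemma sphereMeasure_pos {n : ℕ} (hn : 0 < n) : 0 < sphereMeasure n := by
  have h : (0 : ℝ) < (n : ℝ) / 2 := by positivity
  have := Real.Gamma_pos_of_pos h
  unfold sphereMeasure
  positivity

lemma sphereMeasure_eq_mul_volume_ball {n : ℕ} (hn : 0 < n) :
    sphereMeasure n = n * volume.real (Metric.ball (0 : EuclideanSpace ℝ (Fin n)) 1) := by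
  have : Nonempty (Fin n) := ⟨⟨0, hn⟩⟩
  have h : (0 : ℝ) < (n : ℝ) / 2 := by positivity
  have hΓ := Real.Gamma_pos_of_pos h
  have hn' : (0 : ℝ) < n := by positivity
  rw [Measure.real, EuclideanSpace.volume_ball, Fintype.card_fin, ENNReal.ofReal_one, one_pow,
    one_mul, ENNReal.toReal_ofReal (div_nonneg (by positivity)
      (Real.Gamma_pos_of_pos (by positivity)).le), Real.Gamma_add_one h.ne', sphereMeasure,
    Real.sqrt_eq_rpow, ← Real.rpow_mul_natCast Real.pi_pos.le]
  field_simp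

/-- The radial power `‖x‖ ^ p` is, for `-n < p`, locally integrable on `ℝⁿ`. -/
lemma locallyIntegrable_norm_rpow {n : ℕ} (hn : 0 < n) {p : ℝ} (hp : -(n : ℝ) < p) :
    LocallyIntegrable (fun x : EuclideanSpace ℝ (Fin n) => ‖x‖ ^ p) volume := by
  have : Nonempty (Fin n) := ⟨⟨0, hn⟩⟩
  intro x
  refine ⟨Metric.ball 0 (‖x‖ + 1), Metric.isOpen_ball.mem_nhds (by simp), ?_⟩
  refine (integrableOn_fun_norm_addHaar (f := fun r : ℝ => r ^ p) volume).2 ?_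
  have h : IntegrableOn (fun y : ℝ => y ^ ((n : ℝ) - 1 + p)) (Set.Ioo 0 (‖x‖ + 1)) :=
    (intervalIntegral.integrableOn_Ioo_rpow_iff (by positivity)).2 (by linarith)
  refine h.congr_fun (fun y hy => ?_) measurableSet_Ioo
  have hy0 : 0 < y := hy.1
  simp only [finrank_euclideanSpace, Fintype.card_fin, smul_eq_mul]
  rw [Real.rpow_add hy0, ← Real.rpow_natCast, Nat.cast_pred hn]

section Mollifier

/-- The antiderivative of the radial density `r ^ (n - 1) * (r ^ 2 + 1) ^ (-n / 2 - 1)`. -/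
lemma hasDerivAt_pow_mul_rpow {n : ℕ} (hn : 0 < n) (r : ℝ) :
    HasDerivAt (fun r : ℝ => (n : ℝ)⁻¹ * (r ^ n * (r ^ 2 + 1) ^ (-(n : ℝ) / 2)))
      (r ^ (n - 1) * (r ^ 2 + 1) ^ (-(n : ℝ) / 2 - 1)) r := by
  have hs : 0 < r ^ 2 + 1 := by positivity
  have h1 : HasDerivAt (fun r : ℝ => r ^ 2 + 1) (2 * r) r := by
    simpa using (hasDerivAt_pow 2 r).add_const 1
  have h2 := ((hasDerivAt_pow n r).mul
    (h1.rpow_const (p := -(n : ℝ) / 2) (Or.inl hs.ne'))).const_mul (n : ℝ)⁻¹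
  refine h2.congr_deriv ?_
  have hn' : (n : ℝ) ≠ 0 := by positivity
  have e : (r ^ 2 + 1) ^ (-(n : ℝ) / 2) = (r ^ 2 + 1) ^ (-(n : ℝ) / 2 - 1) * (r ^ 2 + 1) := by
    rw [Real.rpow_sub_one hs.ne', div_mul_cancel₀ _ hs.ne']
  obtain ⟨m, rfl⟩ := Nat.exists_eq_succ_of_ne_zero hn.ne'
  rw [e]
  simp only [Nat.succ_sub_one, Nat.succ_eq_add_one, pow_succ] at *
  field_simp
  ring

lemma tendsto_pow_mul_rpow {n : ℕ} :
    Tendsto (fun r : ℝ => (n : ℝ)⁻¹ * (r ^ n * (r ^ 2 + 1) ^ (-(n : ℝ) / 2))) atTop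
      (𝓝 (n : ℝ)⁻¹) := by
  have h1 : Tendsto (fun r : ℝ => 1 + (r ^ 2)⁻¹) atTop (𝓝 1) := by
    simpa using (tendsto_inv_atTop_zero.comp
      (tendsto_pow_atTop (α := ℝ) two_ne_zero)).const_add 1
  have h2 := (h1.rpow_const (p := -(n : ℝ) / 2) (Or.inl one_ne_zero)).const_mul (n : ℝ)⁻¹
  rw [Real.one_rpow, mul_one] at h2
  refine h2.congr' ?_
  filter_upwards [eventually_gt_atTop 0] with r hr
  have e : r ^ 2 + 1 = r ^ 2 * (1 + (r ^ 2)⁻¹) := by field_simp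
  rw [e, Real.mul_rpow (by positivity) (by positivity), ← Real.rpow_natCast r 2,
    ← Real.rpow_mul hr.le, ← Real.rpow_natCast r n, ← mul_assoc (r ^ (n : ℝ)),
    ← Real.rpow_add hr]
  simp [mul_div_cancel₀]

lemma integrable_mollifier {n : ℕ} :
    Integrable (fun x : EuclideanSpace ℝ (Fin n) => (‖x‖ ^ 2 + 1) ^ (-(n : ℝ) / 2 - 1)) := by
  have := integrable_rpow_neg_one_add_norm_sq (E := EuclideanSpace ℝ (Fin n)) (μ := volume)
    (r := n + 2) (by simp)
  refine this.congr (.of_forall fun x => ?_)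
  simp only
  rw [add_comm, neg_add_rev, add_div, add_comm]
  norm_num [sub_eq_add_neg, add_comm]

lemma integral_mollifier {n : ℕ} (hn : 0 < n) :
    ∫ x : EuclideanSpace ℝ (Fin n), (‖x‖ ^ 2 + 1) ^ (-(n : ℝ) / 2 - 1) =
      sphereMeasure n / n := by
  have : Nonempty (Fin n) := ⟨⟨0, hn⟩⟩
  have hn' : (n : ℝ) ≠ 0 := by positivity
  have h := integral_Ioi_of_hasDerivAt_of_nonneg' (a := 0)
    (fun r _ => hasDerivAt_pow_mul_rpow hn r)
    (fun r (hr : 0 < r) => by positivity) tendsto_pow_mul_rpow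
  rw [integral_fun_norm_addHaar volume (fun r : ℝ => (r ^ 2 + 1) ^ (-(n : ℝ) / 2 - 1)),
    finrank_euclideanSpace, Fintype.card_fin, sphereMeasure_eq_mul_volume_ball hn]
  simp only [smul_eq_mul, nsmul_eq_mul]
  rw [h]
  simp [hn.ne']
  field_simp

end Mollifier

section Regularization

variable {n : ℕ}

lemma hasLineDerivAt_coord (i : Fin n) (x : EuclideanSpace ℝ (Fin n)) :
    HasLineDerivAt ℝ (fun y : EuclideanSpace ℝ (Fin n) => y i) 1 x
      (EuclideanSpace.single i (1 : ℝ)) := by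
  have h : HasDerivAt (fun t : ℝ => x i + t) 1 0 := (hasDerivAt_id 0).const_add _
  simpa [HasLineDerivAt] using h

lemma hasLineDerivAt_normSq_add_rpow {δ : ℝ} (hδ : 0 < δ) (p : ℝ) (i : Fin n)
    (x : EuclideanSpace ℝ (Fin n)) :
    HasLineDerivAt ℝ (fun y : EuclideanSpace ℝ (Fin n) => (‖y‖ ^ 2 + δ) ^ p)
      (2 * p * (x i * (‖x‖ ^ 2 + δ) ^ (p - 1))) x (EuclideanSpace.single i (1 : ℝ)) := by
  have hs : 0 < ‖x‖ ^ 2 + δ := by positivity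
  have h1 := (((hasStrictFDerivAt_norm_sq x).hasFDerivAt.add_const δ).rpow_const
    (p := p) (Or.inl hs.ne')).hasLineDerivAt (EuclideanSpace.single i (1 : ℝ))
  refine HasDerivAt.congr_deriv h1 ?_
  simp [EuclideanSpace.inner_single_right]
  ring

lemma continuous_normSq_add_rpow {δ : ℝ} (hδ : 0 < δ) (p : ℝ) :
    Continuous (fun y : EuclideanSpace ℝ (Fin n) => (‖y‖ ^ 2 + δ) ^ p) :=
  Continuous.rpow_const (by fun_prop) fun y => Or.inl (by positivity)

lemma hasLineDerivAt_coord_mul_normSq_add_rpow {δ : ℝ} (hδ : 0 < δ) (p : ℝ) (i : Fin n)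
    (x : EuclideanSpace ℝ (Fin n)) :
    HasLineDerivAt ℝ (fun y : EuclideanSpace ℝ (Fin n) => y i * (‖y‖ ^ 2 + δ) ^ p)
      ((‖x‖ ^ 2 + δ) ^ p + x i * (2 * p * (x i * (‖x‖ ^ 2 + δ) ^ (p - 1)))) x
      (EuclideanSpace.single i (1 : ℝ)) := by
  refine HasDerivAt.congr_deriv
    (HasDerivAt.mul (hasLineDerivAt_coord i x) (hasLineDerivAt_normSq_add_rpow hδ p i x)) ?_
  simp

variable {φ : EuclideanSpace ℝ (Fin n) → ℂ}

lemma contDiff_fderiv_apply (hφ : ContDiff ℝ (⊤ : ℕ∞) φ) (v : EuclideanSpace ℝ (Fin n)) :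
    ContDiff ℝ (⊤ : ℕ∞) (fun y => fderiv ℝ φ y v) :=
  (hφ.fderiv_right (by simp)).clm_apply contDiff_const

/-- Integration by parts in a fixed direction against a compactly supported smooth function. -/
lemma integral_smul_fderiv_of_hasLineDerivAt (hφ : ContDiff ℝ (⊤ : ℕ∞) φ)
    (hc : HasCompactSupport φ) {g g' : EuclideanSpace ℝ (Fin n) → ℝ}
    {v : EuclideanSpace ℝ (Fin n)} (hg : Continuous g) (hg' : Continuous g')
    (h : ∀ x, HasLineDerivAt ℝ g (g' x) x v) :
    ∫ x, g x • fderiv ℝ φ x v = -∫ x, g' x • φ x := by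
  have hint {f : EuclideanSpace ℝ (Fin n) → ℝ} {ψ : EuclideanSpace ℝ (Fin n) → ℂ}
      (hf : Continuous f) (hψ : Continuous ψ) (hs : HasCompactSupport ψ) :
      Integrable (fun x => f x • ψ x) :=
    (hf.smul hψ).integrable_of_hasCompactSupport hs.smul_left
  exact integral_bilinear_hasLineDerivAt_right_eq_neg_left_of_integrable
    (B := ContinuousLinearMap.lsmul ℝ ℝ)
    (hint hg' hφ.continuous hc)
    (hint hg (contDiff_fderiv_apply hφ v).continuous (hc.fderiv_apply (𝕜 := ℝ) v))
    (hint hg hφ.continuous hc) (fun x _ => h x)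
    (fun x _ => ((hφ.differentiable (by simp)) x).hasFDerivAt.hasLineDerivAt v)

lemma continuous_laplacian (hφ : ContDiff ℝ (⊤ : ℕ∞) φ) : Continuous (laplacian φ) :=
  continuous_finsetSum _ fun _ _ =>
    (contDiff_fderiv_apply (contDiff_fderiv_apply hφ _) _).continuous

lemma hasCompactSupport_laplacian (hc : HasCompactSupport φ) :
    HasCompactSupport (laplacian φ) := by
  refine hc.mono' fun x hx => ?_
  by_contra hx'
  refine hx (Finset.sum_eq_zero fun i _ => ?_)
  let e : EuclideanSpace ℝ (Fin n) := EuclideanSpace.single i (1 : ℝ)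
  have h1 : tsupport (fun y => fderiv ℝ φ y e) ⊆ tsupport φ := tsupport_fderiv_apply_subset ℝ e
  have h2 : tsupport (fun z => fderiv ℝ (fun y => fderiv ℝ φ y e) z e) ⊆
      tsupport (fun y => fderiv ℝ φ y e) := tsupport_fderiv_apply_subset ℝ e
  exact image_eq_zero_of_notMem_tsupport
    (f := fun z => fderiv ℝ (fun y => fderiv ℝ φ y e) z e) fun h => hx' (h1 (h2 h))

/-- Green's identity for the regularized kernel `(‖x‖ ^ 2 + δ) ^ (1 - n / 2)`. -/
lemma integral_regularized_smul_laplacian (hφ : ContDiff ℝ (⊤ : ℕ∞) φ)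
    (hc : HasCompactSupport φ) {δ : ℝ} (hδ : 0 < δ) :
    ∫ x, (‖x‖ ^ 2 + δ) ^ (1 - (n : ℝ) / 2) • laplacian φ x =
      -((((n : ℝ) - 2) * n) • ∫ x, (δ * (‖x‖ ^ 2 + δ) ^ (-(n : ℝ) / 2 - 1)) • φ x) := by
  set a : ℝ := 1 - (n : ℝ) / 2 with ha
  let e (i : Fin n) : EuclideanSpace ℝ (Fin n) := EuclideanSpace.single i (1 : ℝ)
  let K (i : Fin n) (x : EuclideanSpace ℝ (Fin n)) : ℝ :=
    2 * a * ((‖x‖ ^ 2 + δ) ^ (a - 1) + x i * (2 * (a - 1) * (x i * (‖x‖ ^ 2 + δ) ^ (a - 1 - 1))))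
  have hcoord (i : Fin n) : Continuous fun x : EuclideanSpace ℝ (Fin n) => x i := by fun_prop
  have hcont (p : ℝ) := continuous_normSq_add_rpow (n := n) hδ p
  have hK (i : Fin n) : Continuous (K i) :=
    continuous_const.mul ((hcont _).add ((hcoord i).mul
      (continuous_const.mul ((hcoord i).mul (hcont _)))))
  have hparts (i : Fin n) :
      ∫ x, (‖x‖ ^ 2 + δ) ^ a • fderiv ℝ (fun y => fderiv ℝ φ y (e i)) x (e i) =
        ∫ x, K i x • φ x := by
    rw [integral_smul_fderiv_of_hasLineDerivAt (contDiff_fderiv_apply hφ _)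
        (hc.fderiv_apply (𝕜 := ℝ) _) (hcont a)
        (continuous_const.mul ((hcoord i).mul (hcont (a - 1))))
        (hasLineDerivAt_normSq_add_rpow hδ a i),
      integral_smul_fderiv_of_hasLineDerivAt hφ hc
        (continuous_const.mul ((hcoord i).mul (hcont (a - 1)))) (hK i) (fun x => ?_), neg_neg]
    exact HasDerivAt.const_mul (2 * a)
      (hasLineDerivAt_coord_mul_normSq_add_rpow hδ (a - 1) i x)
  simp only [laplacian, Finset.smul_sum]
  rw [integral_finsetSum, Finset.sum_congr rfl (fun i _ => hparts i), ← integral_finsetSum,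
    ← integral_smul, ← integral_neg]
  · refine integral_congr_ae (.of_forall fun x => ?_)
    have hs : 0 < ‖x‖ ^ 2 + δ := by positivity
    have hsum : ∑ i, x i ^ 2 = ‖x‖ ^ 2 := by
      simp [EuclideanSpace.norm_sq_eq]
    have hKs : ∑ i, K i x =
        -((((n : ℝ) - 2) * n) * (δ * (‖x‖ ^ 2 + δ) ^ (-(n : ℝ) / 2 - 1))) := by
      have e1 : (‖x‖ ^ 2 + δ) ^ (a - 1) = (‖x‖ ^ 2 + δ) ^ (a - 1 - 1) * (‖x‖ ^ 2 + δ) := by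
        rw [Real.rpow_sub_one hs.ne' (a - 1), div_mul_cancel₀ _ hs.ne']
      have e2 : -(n : ℝ) / 2 - 1 = a - 1 - 1 := by rw [ha]; ring
      have e3 (i : Fin n) : K i x = 2 * a * (‖x‖ ^ 2 + δ) ^ (a - 1 - 1) * (‖x‖ ^ 2 + δ) +
          4 * a * (a - 1) * (‖x‖ ^ 2 + δ) ^ (a - 1 - 1) * x i ^ 2 := by
        simp only [K, e1]
        ring
      simp only [e3, e2, Finset.sum_add_distrib, ← Finset.mul_sum, hsum]
      simp only [Finset.sum_const, Finset.card_univ, Fintype.card_fin, nsmul_eq_mul]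
      rw [ha]
      ring
    simp only
    rw [← Finset.sum_smul, hKs, smul_smul, neg_smul]
  · exact fun i _ => ((hK i).smul hφ.continuous).integrable_of_hasCompactSupport hc.smul_left
  · exact fun i _ => ((hcont a).smul (contDiff_fderiv_apply (contDiff_fderiv_apply hφ _)
      _).continuous).integrable_of_hasCompactSupport
        ((hc.fderiv_apply (𝕜 := ℝ) _).fderiv_apply (𝕜 := ℝ) _).smul_left

lemma integral_mollifier_rescale {ε : ℝ} (hε : 0 < ε) :
    ∫ x, (ε ^ 2 * (‖x‖ ^ 2 + ε ^ 2) ^ (-(n : ℝ) / 2 - 1)) • φ x =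
      ∫ y, (‖y‖ ^ 2 + 1) ^ (-(n : ℝ) / 2 - 1) • φ (ε • y) := by
  have h := Measure.integral_comp_smul (volume : Measure (EuclideanSpace ℝ (Fin n)))
    (fun x => (ε ^ 2 * (‖x‖ ^ 2 + ε ^ 2) ^ (-(n : ℝ) / 2 - 1)) • φ x) ε
  rw [finrank_euclideanSpace, Fintype.card_fin, abs_of_pos (by positivity)] at h
  rw [← inv_smul_eq_iff₀ (by positivity), inv_inv] at h
  rw [← h, ← integral_smul]
  refine integral_congr_ae (.of_forall fun y => ?_)
  have e : ‖ε • y‖ ^ 2 + ε ^ 2 = ε ^ 2 * (‖y‖ ^ 2 + 1) := by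
    rw [norm_smul, Real.norm_of_nonneg hε.le]; ring
  have e2 : ε ^ n * (ε ^ 2 * (ε ^ 2) ^ (-(n : ℝ) / 2 - 1)) = 1 := by
    rw [← Real.rpow_natCast ε n, ← Real.rpow_natCast ε 2, ← Real.rpow_mul hε.le,
      ← Real.rpow_add hε, ← Real.rpow_add hε]
    convert Real.rpow_zero ε using 2
    push_cast
    ring
  simp only
  rw [e, Real.mul_rpow (by positivity) (by positivity), smul_smul, ← mul_assoc, ← mul_assoc,
    mul_assoc (ε ^ n), e2, one_mul]

lemma tendsto_integral_mollifier (hn : 0 < n) (hφ : Continuous φ) (hc : HasCompactSupport φ) :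
    Tendsto (fun ε : ℝ => ∫ y, (‖y‖ ^ 2 + 1) ^ (-(n : ℝ) / 2 - 1) • φ (ε • y)) (𝓝[>] 0)
      (𝓝 ((sphereMeasure n / n) • φ 0)) := by
  obtain ⟨C, hC⟩ := hc.exists_bound_of_continuous hφ
  rw [← integral_mollifier hn, ← integral_smul_const]
  refine tendsto_integral_filter_of_dominated_convergence
    (fun y => (‖y‖ ^ 2 + 1) ^ (-(n : ℝ) / 2 - 1) * C) (.of_forall fun ε => ?_)
    (.of_forall fun ε => .of_forall fun y => ?_) (integrable_mollifier.mul_const C)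
    (.of_forall fun y => ?_)
  · exact ((continuous_normSq_add_rpow one_pos _).smul
      (hφ.comp (continuous_const_smul ε))).aestronglyMeasurable
  · rw [norm_smul, Real.norm_of_nonneg (by positivity)]
    exact mul_le_mul_of_nonneg_left (hC _) (by positivity)
  · have h : Continuous fun ε : ℝ => (‖y‖ ^ 2 + 1) ^ (-(n : ℝ) / 2 - 1) • φ (ε • y) := by fun_prop
    simpa using (h.tendsto 0).mono_left nhdsWithin_le_nhds

lemma tendsto_integral_regularized (hn : 2 ≤ n) {ψ : EuclideanSpace ℝ (Fin n) → ℂ}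
    (hψ : Continuous ψ) (hc : HasCompactSupport ψ) :
    Tendsto (fun ε : ℝ => ∫ x, (‖x‖ ^ 2 + ε ^ 2) ^ (1 - (n : ℝ) / 2) • ψ x) (𝓝[>] 0)
      (𝓝 (∫ x, ‖x‖ ^ ((2 : ℝ) - n) • ψ x)) := by
  have hn' : (2 : ℝ) ≤ n := by exact_mod_cast hn
  have : Nonempty (Fin n) := ⟨⟨0, by omega⟩⟩
  have hpow (x : EuclideanSpace ℝ (Fin n)) :
      (‖x‖ ^ 2) ^ (1 - (n : ℝ) / 2) = ‖x‖ ^ ((2 : ℝ) - n) := by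
    rw [← Real.rpow_natCast, ← Real.rpow_mul (norm_nonneg x)]
    congr 1
    push_cast
    ring
  have hne : ∀ᵐ x : EuclideanSpace ℝ (Fin n), x ≠ 0 := Measure.ae_ne volume 0
  have hint : Integrable (fun x => ‖x‖ ^ ((2 : ℝ) - n) • ψ x) :=
    (locallyIntegrable_norm_rpow (by omega)
      (by linarith)).integrable_smul_right_of_hasCompactSupport hψ hc
  refine tendsto_integral_filter_of_dominated_convergence _ ?_ ?_ hint.norm ?_
  · filter_upwards [self_mem_nhdsWithin] with ε (hε : 0 < ε)
    exact ((continuous_normSq_add_rpow (by positivity) _).smul hψ).aestronglyMeasurable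
  · refine .of_forall fun ε => ?_
    filter_upwards [hne] with x hx
    have hx' : 0 < ‖x‖ := norm_pos_iff.2 hx
    rw [norm_smul, norm_smul, ← hpow, Real.norm_of_nonneg (by positivity),
      Real.norm_of_nonneg (by positivity)]
    refine mul_le_mul_of_nonneg_right ?_ (norm_nonneg _)
    exact Real.rpow_le_rpow_of_nonpos (by positivity) (by nlinarith [sq_nonneg ε]) (by linarith)
  · filter_upwards [hne] with x hx
    have hx' : 0 < ‖x‖ := norm_pos_iff.2 hx
    have h : Continuous fun ε : ℝ => (‖x‖ ^ 2 + ε ^ 2) ^ (1 - (n : ℝ) / 2) • ψ x :=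
      (Continuous.rpow_const (by fun_prop) fun ε => Or.inl (by positivity)).smul continuous_const
    simpa [hpow] using (h.tendsto 0).mono_left nhdsWithin_le_nhds

lemma integral_norm_rpow_smul_laplacian (hn : 2 ≤ n) (hφ : ContDiff ℝ (⊤ : ℕ∞) φ)
    (hc : HasCompactSupport φ) :
    ∫ x, ‖x‖ ^ ((2 : ℝ) - n) • laplacian φ x = -((((n : ℝ) - 2) * sphereMeasure n) • φ 0) := by
  have hn' : (n : ℝ) ≠ 0 := by positivity
  refine tendsto_nhds_unique (tendsto_integral_regularized hn (continuous_laplacian hφ)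
    (hasCompactSupport_laplacian hc)) ?_
  have h := ((tendsto_integral_mollifier (by omega) hφ.continuous hc).const_smul
    (((n : ℝ) - 2) * n)).neg
  rw [smul_smul, mul_assoc, mul_div_cancel₀ _ hn'] at h
  refine h.congr' ?_
  filter_upwards [self_mem_nhdsWithin] with ε (hε : 0 < ε)
  rw [integral_regularized_smul_laplacian hφ hc (pow_pos hε 2), integral_mollifier_rescale hε]

end Regularization

/-- For `n ≥ 3` the function `𝒢(x) = |x|^{2-n}/((n-2)σ_n)` is locally
integrable on `ℝⁿ` and is a fundamental solution of `-Δ`: for every smooth compactly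
supported `φ : ℝⁿ → ℂ` one has `-∫ 𝒢(x) Δφ(x) dx = φ(0)`. -/
theorem greenFn_fundamental_solution (n : ℕ) (hn : 3 ≤ n) :
    MeasureTheory.LocallyIntegrable (greenFn n) MeasureTheory.volume ∧
    ∀ φ : EuclideanSpace ℝ (Fin n) → ℂ, ContDiff ℝ (⊤ : ℕ∞) φ → HasCompactSupport φ →
      -∫ x : EuclideanSpace ℝ (Fin n),
          (greenFn n x : ℂ) * laplacian φ x ∂MeasureTheory.volume = φ 0 := by
  have hn' : (3 : ℝ) ≤ n := by exact_mod_cast hn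
  have hσ := sphereMeasure_pos (n := n) (by omega)
  refine ⟨(locallyIntegrable_norm_rpow (by omega) (by linarith)).smul
    (1 / (((n : ℝ) - 2) * sphereMeasure n)), fun φ hφ hc => ?_⟩
  have hne : ((n : ℝ) - 2) * sphereMeasure n ≠ 0 := mul_ne_zero (by linarith) hσ.ne'
  have h (x : EuclideanSpace ℝ (Fin n)) : (greenFn n x : ℂ) * laplacian φ x =
      (1 / (((n : ℝ) - 2) * sphereMeasure n)) • ‖x‖ ^ ((2 : ℝ) - n) • laplacian φ x := by
    rw [smul_smul, Complex.real_smul, greenFn]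
  simp only [h]
  rw [integral_smul, integral_norm_rpow_smul_laplacian (by omega) hφ hc, smul_neg, neg_neg,
    smul_smul, one_div_mul_cancel hne, one_smul]

end SingPert
end
end

section
/- Let n > 4. There exists a constant c > 0 such that for every Schwartz function φ : ℝⁿ → ℂ one has ‖φ‖_{L^{2n/(n−4)}(ℝⁿ)} ≤ c ‖Δφ‖_{L²(ℝⁿ)}. -/
open Complex Filter Topology MeasureTheory
open scoped ENNReal

noncomputable section

namespace SingPert

section Helpers

open scoped LineDeriv FourierTransform Laplacian NNReal

variable {V F : Type*} [NormedAddCommGroup V] [InnerProductSpace ℝ V] [FiniteDimensional ℝ V]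
  [MeasurableSpace V] [BorelSpace V]

/-- The Gagliardo-Nirenberg-Sobolev inequality for Schwartz functions. -/
theorem eLpNorm_schwartz_le_eLpNorm_fderiv [NormedAddCommGroup F] [NormedSpace ℝ F]
    [FiniteDimensional ℝ F] (f : SchwartzMap V F) {p q : ℝ≥0} (hp : 1 ≤ p)
    (hn : 0 < Module.finrank ℝ V) (hq : (q : ℝ)⁻¹ = p⁻¹ - (Module.finrank ℝ V : ℝ)⁻¹) :
    eLpNorm f q volume ≤
      SNormLESNormFDerivOfEqConst F (volume : Measure V) p * eLpNorm (fderiv ℝ f) p volume := by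
  set C := SNormLESNormFDerivOfEqConst F (volume : Measure V) p
  let χ : ContDiffBump (0 : V) := ⟨1, 2, one_pos, one_lt_two⟩
  have hχ : ContDiff ℝ 1 χ := χ.contDiff
  obtain ⟨M, hM⟩ : ∃ M, ∀ x, ‖fderiv ℝ χ x‖ ≤ M :=
    (hχ.continuous_fderiv one_ne_zero).bounded_above_of_compact_support
      (χ.hasCompactSupport.fderiv ℝ)
  let r : ℕ → ℝ := fun k => 1 / ((k : ℝ) + 1)
  have hr : ∀ k, 0 < r k := fun k => by positivity
  have hr0 : Tendsto r atTop (𝓝 0) := tendsto_one_div_add_atTop_nhds_zero_nat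
  let u : ℕ → V → F := fun k x => χ (r k • x) • f x
  have hf1 : ContDiff ℝ 1 f := f.smooth 1
  have hχk : ∀ k, ContDiff ℝ 1 (fun x => χ (r k • x)) := fun k =>
    hχ.comp (contDiff_id.const_smul (r k))
  have hu : ∀ k, ContDiff ℝ 1 (u k) := fun k => (hχk k).smul hf1
  have hcs : ∀ k, HasCompactSupport (u k) := fun k =>
    (χ.hasCompactSupport.comp_homeomorph (Homeomorph.smulOfNeZero (r k) (hr k).ne')).smul_right
  have hlim : ∀ x, Tendsto (fun k => u k x) atTop (𝓝 (f x)) := fun x => by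
    have h1 : Tendsto (fun k => χ (r k • x)) atTop (𝓝 (χ ((0 : ℝ) • x))) :=
      (χ.continuous.tendsto _).comp (hr0.smul_const x)
    have h2 : χ ((0 : ℝ) • x) = 1 := by
      rw [zero_smul]; exact χ.one_of_mem_closedBall (by simp [χ])
    rw [h2] at h1
    simpa using h1.smul_const (f x)
  have hder : ∀ k x, ‖fderiv ℝ (u k) x‖ ≤ ‖fderiv ℝ f x‖ + M * r k * ‖f x‖ := fun k x => by
    have hd : HasFDerivAt (fun x => χ (r k • x))
        ((fderiv ℝ χ (r k • x)).comp (r k • ContinuousLinearMap.id ℝ V)) x :=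
      ((hχ.differentiable one_ne_zero) (r k • x)).hasFDerivAt.comp x
        ((hasFDerivAt_id x).const_smul (r k))
    have hdu : HasFDerivAt (u k) _ x := hd.smul (f.hasFDerivAt x)
    rw [hdu.fderiv]
    refine (norm_add_le _ _).trans (add_le_add ?_ ?_)
    · rw [norm_smul, Real.norm_of_nonneg χ.nonneg]
      exact mul_le_of_le_one_left (norm_nonneg _) χ.le_one
    · rw [ContinuousLinearMap.norm_smulRight_apply]
      gcongr
      rw [ContinuousLinearMap.comp_smul, ContinuousLinearMap.comp_id, norm_smul,
        Real.norm_of_nonneg (hr k).le, mul_comm]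
      exact mul_le_mul_of_nonneg_right (hM _) (hr k).le
  have hp' : (1 : ℝ≥0∞) ≤ p := by exact_mod_cast hp
  have hbound : ∀ k, eLpNorm (u k) q volume ≤
      C * (eLpNorm (fderiv ℝ f) p volume + ENNReal.ofReal (M * r k) * eLpNorm f p volume) :=
    fun k => by
    refine (eLpNorm_le_eLpNorm_fderiv_of_eq volume (hu k) (hcs k) hp hn hq).trans ?_
    gcongr
    have hM0 : 0 ≤ M := (norm_nonneg _).trans (hM 0)
    calc eLpNorm (fderiv ℝ (u k)) p volume
        ≤ eLpNorm ((fun x => ‖fderiv ℝ f x‖) + fun x => (M * r k) * ‖f x‖) p volume :=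
          eLpNorm_mono_real (hder k)
      _ ≤ eLpNorm (fun x => ‖fderiv ℝ f x‖) p volume +
          eLpNorm (fun x => (M * r k) * ‖f x‖) p volume :=
          eLpNorm_add_le
            (hf1.continuous_fderiv one_ne_zero).norm.aestronglyMeasurable
            (continuous_const.mul f.continuous.norm).aestronglyMeasurable hp'
      _ = _ := by
          rw [eLpNorm_norm]
          congr 1
          have := eLpNorm_const_smul (M * r k) (fun x => ‖f x‖) p (volume : Measure V)
          rw [eLpNorm_norm, Real.enorm_of_nonneg (mul_nonneg hM0 (hr k).le)] at this
          exact this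
  have hT : Tendsto (fun k => (C : ℝ≥0∞) * (eLpNorm (fderiv ℝ f) p volume +
      ENNReal.ofReal (M * r k) * eLpNorm f p volume)) atTop
      (𝓝 (C * eLpNorm (fderiv ℝ f) p volume)) := by
    have h0 : Tendsto (fun k => ENNReal.ofReal (M * r k)) atTop (𝓝 0) := by
      simpa using ENNReal.tendsto_ofReal (hr0.const_mul M)
    have h1 := ENNReal.Tendsto.mul_const (b := eLpNorm f p volume) h0
      (Or.inr (f.memLp p volume).2.ne)
    have h2 := ENNReal.Tendsto.const_mul (a := (C : ℝ≥0∞))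
      (h1.const_add (eLpNorm (fderiv ℝ f) p volume)) (Or.inr ENNReal.coe_ne_top)
    simpa using h2
  calc eLpNorm f q volume ≤ liminf (fun k => eLpNorm (u k) q volume) atTop :=
        Lp.eLpNorm_lim_le_liminf_eLpNorm
          (fun k => (hu k).continuous.aestronglyMeasurable) f (Eventually.of_forall hlim)
    _ ≤ liminf (fun k => (C : ℝ≥0∞) * (eLpNorm (fderiv ℝ f) p volume +
          ENNReal.ofReal (M * r k) * eLpNorm f p volume)) atTop :=
        liminf_le_liminf (Eventually.of_forall hbound)
    _ = _ := hT.liminf_eq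

/-- The `L^p` norm of the derivative is at most the sum of those of the partial derivatives. -/
theorem eLpNorm_fderiv_le_sum_lineDeriv [NormedAddCommGroup F] [NormedSpace ℝ F]
    {ι : Type*} [Fintype ι] (b : OrthonormalBasis ι ℝ V)
    (f : SchwartzMap V F) {p : ℝ≥0∞} (hp : 1 ≤ p) :
    eLpNorm (fderiv ℝ f) p volume ≤ ∑ i, eLpNorm (∂_{b i} f : SchwartzMap V F) p volume := by
  have hpt : ∀ x, ‖fderiv ℝ f x‖ ≤ (∑ i, fun x => ‖(∂_{b i} f : SchwartzMap V F) x‖) x :=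
    fun x => by
    rw [Finset.sum_apply]
    refine ContinuousLinearMap.opNorm_le_bound _ (by positivity) fun v => ?_
    conv_lhs => rw [← b.sum_repr v, map_sum]
    rw [Finset.sum_mul]
    refine norm_sum_le_of_le _ fun i _ => ?_
    rw [map_smul, norm_smul, SchwartzMap.lineDerivOp_apply_eq_fderiv, mul_comm]
    gcongr
    rw [← b.repr.norm_map v]
    exact PiLp.norm_apply_le _ i
  refine (eLpNorm_mono_real hpt).trans ((eLpNorm_sum_le (fun i _ =>
    (∂_{b i} f : SchwartzMap V F).continuous.norm.aestronglyMeasurable) hp).trans_eq ?_)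
  simp only [eLpNorm_norm]

section Fourier

variable [NormedAddCommGroup F] [InnerProductSpace ℂ F]

theorem fourier_lineDeriv_apply (f : SchwartzMap V F) (m ξ : V) :
    (𝓕 (∂_{m} f : SchwartzMap V F) : SchwartzMap V F) ξ =
      (2 * Real.pi * I * (inner ℝ ξ m : ℝ)) • (𝓕 f : SchwartzMap V F) ξ := by
  have : (inner ℝ · m).HasTemperateGrowth := ((innerSL ℝ).flip m).hasTemperateGrowth
  rw [SchwartzMap.fourier_lineDerivOp_eq, smul_apply,
    SchwartzMap.smulLeftCLM_apply_apply this, ← Complex.coe_smul, smul_smul]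

variable [CompleteSpace F]

theorem eLpNorm_two_le_of_norm_fourier_le (f g : SchwartzMap V F)
    (h : ∀ ξ, ‖(𝓕 f : SchwartzMap V F) ξ‖ ≤ ‖(𝓕 g : SchwartzMap V F) ξ‖) : eLpNorm f 2 volume ≤ eLpNorm g 2 volume := by
  have key : ∀ f : SchwartzMap V F, eLpNorm (𝓕 f : SchwartzMap V F) 2 volume = eLpNorm f 2 volume := fun f => by
    rw [← ENNReal.toReal_eq_toReal_iff' ((𝓕 f : SchwartzMap V F).memLp 2 volume).2.ne
        (f.memLp 2 volume).2.ne,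
      ← SchwartzMap.norm_toLp, ← SchwartzMap.norm_toLp, SchwartzMap.norm_fourier_toL2_eq]
  rw [← key f, ← key g]
  exact eLpNorm_mono h

theorem eLpNorm_lineDeriv_lineDeriv_le_laplacian {ι : Type*} [Fintype ι]
    (b : OrthonormalBasis ι ℝ V) (f : SchwartzMap V F) (i j : ι) :
    eLpNorm (∂_{b j} (∂_{b i} f) : SchwartzMap V F) 2 volume ≤
      eLpNorm (Δ f : SchwartzMap V F) 2 volume := by
  refine eLpNorm_two_le_of_norm_fourier_le _ _ fun ξ => ?_
  have hsum : (𝓕 (Δ f : SchwartzMap V F) : SchwartzMap V F) ξ =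
      (-(2 * Real.pi * ‖ξ‖) ^ 2 : ℂ) • (𝓕 f : SchwartzMap V F) ξ := by
    rw [SchwartzMap.laplacian_eq_sum b,
      show (𝓕 (∑ i, ∂_{b i} (∂_{b i} f) : SchwartzMap V F) : SchwartzMap V F) =
        ∑ i, (𝓕 (∂_{b i} (∂_{b i} f) : SchwartzMap V F) : SchwartzMap V F) from
        map_sum (FourierTransform.fourierCLE ℂ (SchwartzMap V F)) _ _]
    rw [sum_apply]
    simp only [fourier_lineDeriv_apply, smul_smul, ← Finset.sum_smul]
    congr 1
    have hn : (‖ξ‖ : ℂ) ^ 2 = ∑ i, ((inner ℝ ξ (b i) : ℝ) : ℂ) ^ 2 := by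
      rw [← ofReal_pow, ← b.sum_sq_inner_right ξ]
      push_cast
      simp only [real_inner_comm]
    rw [mul_pow, hn, Finset.mul_sum, ← Finset.sum_neg_distrib]
    refine Finset.sum_congr rfl fun i _ => ?_
    linear_combination (2 * Real.pi * (inner ℝ ξ (b i) : ℝ) : ℂ) ^ 2 * I_sq
  rw [hsum, fourier_lineDeriv_apply, fourier_lineDeriv_apply, smul_smul, norm_smul, norm_smul]
  gcongr
  have hc : ∀ k, |inner ℝ ξ (b k)| ≤ ‖ξ‖ := fun k => by
    simpa using abs_real_inner_le_norm ξ (b k)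
  simp only [norm_mul, norm_neg, norm_pow, norm_I, norm_real, Real.norm_eq_abs, abs_norm,
    RCLike.norm_ofNat, mul_one, abs_of_pos Real.pi_pos]
  calc 2 * Real.pi * |inner ℝ ξ (b j)| * (2 * Real.pi * |inner ℝ ξ (b i)|)
      ≤ 2 * Real.pi * ‖ξ‖ * (2 * Real.pi * ‖ξ‖) := by
        gcongr <;> exact hc _
    _ = _ := by ring

end Fourier

end Helpers

theorem laplacian_eq_schwartz_laplacian {n : ℕ} (φ : SchwartzMap (EuclideanSpace ℝ (Fin n)) ℂ) :
    laplacian ⇑φ = ⇑(Laplacian.laplacian φ : SchwartzMap (EuclideanSpace ℝ (Fin n)) ℂ) := by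
  ext x
  rw [SchwartzMap.laplacian_eq_sum (EuclideanSpace.basisFun (Fin n) ℝ), sum_apply]
  refine Finset.sum_congr rfl fun i _ => ?_
  simp only [EuclideanSpace.basisFun_apply, SchwartzMap.lineDerivOp_apply_eq_fderiv]
  congr 2

/-- For `n > 4` there is a constant `c > 0` such that for every Schwartz
function `φ : ℝⁿ → ℂ` one has `‖φ‖_{L^{2n/(n-4)}} ≤ c ‖Δφ‖_{L²}`. -/
theorem sobolev_inequality_laplacian (n : ℕ) (hn : 4 < n) :
    ∃ c : ℝ, 0 < c ∧
      ∀ φ : SchwartzMap (EuclideanSpace ℝ (Fin n)) ℂ,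
        MeasureTheory.eLpNorm (⇑φ)
            (ENNReal.ofReal (2 * (n : ℝ) / ((n : ℝ) - 4))) MeasureTheory.volume ≤
          ENNReal.ofReal c *
            MeasureTheory.eLpNorm (laplacian ⇑φ) 2 MeasureTheory.volume := by
  let E := EuclideanSpace ℝ (Fin n)
  have hn' : (4 : ℝ) < n := by exact_mod_cast hn
  let b := EuclideanSpace.basisFun (Fin n) ℝ
  have hfin : Module.finrank ℝ E = n := finrank_euclideanSpace_fin
  have hpos : 0 < Module.finrank ℝ E := by omega
  let q : NNReal := Real.toNNReal (2 * n / (n - 2))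
  let s : NNReal := Real.toNNReal (2 * n / (n - 4))
  have hq : (q : ℝ) = 2 * n / (n - 2) :=
    Real.coe_toNNReal _ (div_nonneg (by positivity) (by linarith))
  have hs : (s : ℝ) = 2 * n / (n - 4) :=
    Real.coe_toNNReal _ (div_nonneg (by positivity) (by linarith))
  have hq1 : 1 ≤ q := by
    rw [← NNReal.coe_le_coe, hq, NNReal.coe_one, le_div_iff₀ (by linarith)]
    linarith
  have hn0 : (n : ℝ) ≠ 0 := by linarith
  have hq2 : (q : ℝ)⁻¹ = ((2 : NNReal) : ℝ)⁻¹ - (Module.finrank ℝ E : ℝ)⁻¹ := by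
    rw [hq, hfin, inv_div, NNReal.coe_ofNat]
    field_simp
  have hsq : (s : ℝ)⁻¹ = (q : ℝ)⁻¹ - (Module.finrank ℝ E : ℝ)⁻¹ := by
    rw [hs, hq, hfin, inv_div, inv_div]
    field_simp
    ring
  let C₁ := SNormLESNormFDerivOfEqConst ℂ (volume : Measure E) (2 : NNReal)
  let C₂ := SNormLESNormFDerivOfEqConst ℂ (volume : Measure E) q
  let c : NNReal := C₂ * (n * (C₁ * n))
  refine ⟨c + 1, by positivity, fun φ => ?_⟩
  rw [laplacian_eq_schwartz_laplacian]
  set L := eLpNorm (Laplacian.laplacian φ : SchwartzMap E ℂ) 2 volume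
  have first : ∀ i, eLpNorm (LineDeriv.lineDerivOp (b i) φ : SchwartzMap E ℂ) q volume ≤
      C₁ * (n * L) := fun i => by
    refine (eLpNorm_schwartz_le_eLpNorm_fderiv _ one_le_two hpos hq2).trans ?_
    gcongr
    refine (eLpNorm_fderiv_le_sum_lineDeriv b (LineDeriv.lineDerivOp (b i) φ : SchwartzMap E ℂ)
      (p := (2 : NNReal)) (by exact_mod_cast one_le_two)).trans ?_
    refine (Finset.sum_le_card_nsmul _ _ L fun j _ =>
      eLpNorm_lineDeriv_lineDeriv_le_laplacian b φ i j).trans_eq ?_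
    simp
  calc eLpNorm φ s volume ≤ C₂ * eLpNorm (fderiv ℝ φ) q volume :=
        eLpNorm_schwartz_le_eLpNorm_fderiv φ hq1 hpos hsq
    _ ≤ C₂ * (n * (C₁ * (n * L))) := by
        gcongr
        refine (eLpNorm_fderiv_le_sum_lineDeriv b φ (by exact_mod_cast hq1)).trans ?_
        refine (Finset.sum_le_card_nsmul _ _ _ fun i _ => first i).trans_eq ?_
        simp
    _ = c * L := by simp only [c]; push_cast; ring
    _ ≤ ENNReal.ofReal (c + 1) * L := by
        gcongr
        rw [← ENNReal.ofReal_coe_nnreal]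
        exact ENNReal.ofReal_le_ofReal (by linarith)

end SingPert
end
end

section
/- Let n > 2. There exists a constant c > 0 such that for every Schwartz function φ : ℝⁿ → ℂ one has ‖∇φ‖_{L^{2n/(n−2)}(ℝⁿ)} ≤ c ‖Δφ‖_{L²(ℝⁿ)}, where ‖∇φ‖_{L^p} denotes the L^p norm of the Euclidean norm of the gradient of φ. -/
open Complex Filter Topology MeasureTheory
open scoped ENNReal

noncomputable section

namespace SingPert

/-- The pointwise Euclidean norm `|∇φ(x)| = (∑ i |∂ᵢφ(x)|²)^{1/2}` of the gradient. -/
def gradNorm {n : ℕ} (φ : EuclideanSpace ℝ (Fin n) → ℂ)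
    (x : EuclideanSpace ℝ (Fin n)) : ℝ :=
  Real.sqrt (∑ i : Fin n, ‖fderiv ℝ φ x (EuclideanSpace.single i (1 : ℝ))‖ ^ 2)

open Module LineDeriv FourierTransform Laplacian
open scoped NNReal SchwartzMap

section GagliardoNirenbergSobolev

variable {E F : Type*} [NormedAddCommGroup E] [NormedSpace ℝ E]
  [NormedAddCommGroup F] [NormedSpace ℝ F]

/-- There is a compactly supported, continuously differentiable cutoff function bounded by `1`,
equal to `1` near the origin and with bounded derivative. -/
theorem exists_cutoff [FiniteDimensional ℝ E] : ∃ (χ : E → ℝ) (K : ℝ),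
    ContDiff ℝ 1 χ ∧ HasCompactSupport χ ∧ (∀ x, ‖χ x‖ ≤ 1) ∧
    (∀ᶠ x in 𝓝 0, χ x = 1) ∧ 0 ≤ K ∧ ∀ x, ‖fderiv ℝ χ x‖ ≤ K := by
  let χ : ContDiffBump (0 : E) := ⟨1, 2, one_pos, one_lt_two⟩
  have hχ : ContDiff ℝ 1 χ := χ.contDiff
  obtain ⟨K, hK⟩ := (χ.hasCompactSupport.fderiv ℝ).exists_bound_of_continuous
    (hχ.continuous_fderiv one_ne_zero)
  refine ⟨χ, K, hχ, χ.hasCompactSupport, fun x => ?_, χ.eventuallyEq_one,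
    (norm_nonneg _).trans (hK 0), hK⟩
  rw [Real.norm_of_nonneg χ.nonneg]
  exact χ.le_one

theorem norm_fderiv_comp_smul_smul_le {χ : E → ℝ} {K ε : ℝ} (hχ : ContDiff ℝ 1 χ)
    (hχ1 : ∀ x, ‖χ x‖ ≤ 1) (hK : ∀ x, ‖fderiv ℝ χ x‖ ≤ K) (hε : 0 ≤ ε) {u : E → F}
    (hu : ContDiff ℝ 1 u) (x : E) :
    ‖fderiv ℝ (fun y => χ (ε • y) • u y) x‖ ≤ ‖fderiv ℝ u x‖ + ε * K * ‖u x‖ := by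
  have hd : DifferentiableAt ℝ χ (ε • x) := hχ.differentiable one_ne_zero _
  have h1 : DifferentiableAt ℝ (fun y => χ (ε • y)) x := by fun_prop
  rw [fderiv_fun_smul h1 (hu.differentiable one_ne_zero x), fderiv_comp_smul]
  refine (norm_add_le _ _).trans (add_le_add ?_ ?_)
  · rw [norm_smul]
    exact mul_le_of_le_one_left (norm_nonneg _) (hχ1 _)
  · rw [ContinuousLinearMap.norm_smulRight_apply, norm_smul, Real.norm_of_nonneg hε]
    gcongr
    exact hK _

variable [FiniteDimensional ℝ E] [MeasurableSpace E] [BorelSpace E] [FiniteDimensional ℝ F]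

/-- The **Gagliardo-Nirenberg-Sobolev inequality** for continuously differentiable functions in
`Lᵖ`, without any assumption on the support. -/
theorem eLpNorm_le_eLpNorm_fderiv_of_memLp (μ : Measure E) [μ.IsAddHaarMeasure] {u : E → F}
    {p p' : ℝ≥0} (hu : ContDiff ℝ 1 u) (hup : MemLp u p μ) (hp : 1 ≤ p) (hn : 0 < finrank ℝ E)
    (hp' : (p' : ℝ)⁻¹ = (p : ℝ)⁻¹ - (finrank ℝ E : ℝ)⁻¹) :
    eLpNorm u p' μ ≤ SNormLESNormFDerivOfEqConst F μ p * eLpNorm (fderiv ℝ u) p μ := by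
  obtain ⟨χ, K, hχ, hχc, hχ1, hχ0, hK0, hK⟩ := exists_cutoff (E := E)
  let ε : ℕ → ℝ := fun N => 1 / ((N : ℝ) + 1)
  have hε : ∀ N, 0 < ε N := fun N => Nat.one_div_pos_of_nat
  have hε0 : Tendsto ε atTop (𝓝 0) := tendsto_one_div_add_atTop_nhds_zero_nat
  let v : ℕ → E → F := fun N x => χ (ε N • x) • u x
  have hv : ∀ N, ContDiff ℝ 1 (v N) := fun N => (hχ.comp (contDiff_const_smul _)).smul hu
  have hvc : ∀ N, HasCompactSupport (v N) := fun N =>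
    (hχc.comp_smul (hε N).ne').smul_right
  have hlim : ∀ x, Tendsto (fun N => v N x) atTop (𝓝 (u x)) := by
    intro x
    have h : Tendsto (fun N => ε N • x) atTop (𝓝 0) := by
      simpa using hε0.smul_const x
    refine tendsto_const_nhds.congr' ?_
    filter_upwards [h.eventually hχ0] with N hN
    simp [v, hN]
  have hfd : ∀ N, eLpNorm (fderiv ℝ (v N)) p μ ≤
      eLpNorm (fderiv ℝ u) p μ + ENNReal.ofReal (ε N * K) * eLpNorm u p μ := by
    intro N
    have hm : AEStronglyMeasurable (fun x => ‖fderiv ℝ u x‖) μ :=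
      (hu.continuous_fderiv one_ne_zero).norm.aestronglyMeasurable
    calc eLpNorm (fderiv ℝ (v N)) p μ
        ≤ eLpNorm ((fun x => ‖fderiv ℝ u x‖) + fun x => ε N * K * ‖u x‖) p μ :=
          eLpNorm_mono_real
            (norm_fderiv_comp_smul_smul_le hχ hχ1 hK (hε N).le hu)
      _ ≤ eLpNorm (fun x => ‖fderiv ℝ u x‖) p μ + eLpNorm (fun x => ε N * K * ‖u x‖) p μ :=
          eLpNorm_add_le hm (hup.1.norm.const_mul _) (mod_cast hp)
      _ ≤ _ := by
          gcongr
          · exact (eLpNorm_norm _).le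
          · refine eLpNorm_le_mul_eLpNorm_of_ae_le_mul (.of_forall fun x => ?_) _
            rw [norm_mul, norm_norm, Real.norm_of_nonneg (mul_nonneg (hε N).le hK0)]
  let C : ℝ≥0∞ := SNormLESNormFDerivOfEqConst F μ p
  have hbound : ∀ N, eLpNorm (v N) p' μ ≤
      C * (eLpNorm (fderiv ℝ u) p μ + ENNReal.ofReal (ε N * K) * eLpNorm u p μ) := fun N =>
    (eLpNorm_le_eLpNorm_fderiv_of_eq μ (hv N) (hvc N) hp hn hp').trans
      (mul_le_mul_right (hfd N) C)
  have hblim : Tendsto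
      (fun N => C * (eLpNorm (fderiv ℝ u) p μ + ENNReal.ofReal (ε N * K) * eLpNorm u p μ)) atTop
      (𝓝 (C * eLpNorm (fderiv ℝ u) p μ)) := by
    have h1 : Tendsto (fun N => ENNReal.ofReal (ε N * K)) atTop (𝓝 0) := by
      simpa using ENNReal.tendsto_ofReal (hε0.mul_const K)
    have h2 := ENNReal.Tendsto.mul_const (b := eLpNorm u p μ) h1 (.inr hup.eLpNorm_ne_top)
    have h3 := ENNReal.Tendsto.const_mul (a := C) (h2.const_add (eLpNorm (fderiv ℝ u) p μ))
      (.inr ENNReal.coe_ne_top)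
    simpa using h3
  calc eLpNorm u p' μ ≤ liminf (fun N => eLpNorm (v N) p' μ) atTop :=
        Lp.eLpNorm_lim_le_liminf_eLpNorm
          (fun N => (hv N).continuous.aestronglyMeasurable) u (.of_forall hlim)
    _ ≤ _ := (liminf_le_liminf (.of_forall hbound)).trans hblim.liminf_eq.le

end GagliardoNirenbergSobolev

section SecondDerivatives

variable {V : Type*} [NormedAddCommGroup V] [InnerProductSpace ℝ V] [FiniteDimensional ℝ V]
  [MeasurableSpace V] [BorelSpace V]

theorem fourier_lineDerivOp_lineDerivOp_apply (f : 𝓢(V, ℂ)) (a b x : V) :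
    𝓕 (∂_{a} (∂_{b} f)) x =
      (2 * Real.pi * I) ^ 2 * (inner ℝ x a * inner ℝ x b : ℝ) * 𝓕 f x := by
  have ha : (fun y : V => inner ℝ y a).HasTemperateGrowth := by fun_prop
  have hb : (fun y : V => inner ℝ y b).HasTemperateGrowth := by fun_prop
  simp only [SchwartzMap.fourier_lineDerivOp_eq, smul_apply,
    SchwartzMap.smulLeftCLM_apply_apply ha, SchwartzMap.smulLeftCLM_apply_apply hb,
    smul_eq_mul, real_smul]
  push_cast
  ring

theorem fourier_laplacian_apply (f : 𝓢(V, ℂ)) (x : V) :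
    𝓕 (Δ f) x = (2 * Real.pi * I) ^ 2 * (‖x‖ ^ 2 : ℝ) * 𝓕 f x := by
  let b := stdOrthonormalBasis ℝ V
  have h : 𝓕 (Δ f) = ∑ i, 𝓕 (∂_{b i} (∂_{b i} f)) := by
    rw [SchwartzMap.laplacian_eq_sum b, ← FourierTransform.fourierCLM_apply (R := ℂ), map_sum]
    rfl
  rw [h, sum_apply, ← b.sum_sq_inner_left x]
  simp only [fourier_lineDerivOp_lineDerivOp_apply, ← Finset.sum_mul, ← Finset.mul_sum]
  push_cast
  simp [pow_two]

theorem eLpNorm_fourier_two (f : 𝓢(V, ℂ)) : 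
    eLpNorm (𝓕 f : 𝓢(V, ℂ)) 2 volume = eLpNorm f 2 volume := by
  have h := SchwartzMap.norm_fourier_toL2_eq f
  rw [SchwartzMap.norm_toLp, SchwartzMap.norm_toLp] at h
  exact (ENNReal.toReal_eq_toReal_iff' (SchwartzMap.eLpNorm_lt_top _ _ _).ne
    (SchwartzMap.eLpNorm_lt_top _ _ _).ne).1 h

/-- The second derivatives of a Schwartz function in unit directions are bounded in `L²` by its
Laplacian. -/
theorem eLpNorm_lineDerivOp_lineDerivOp_le (f : 𝓢(V, ℂ)) {a b : V} (ha : ‖a‖ ≤ 1)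
    (hb : ‖b‖ ≤ 1) :
    eLpNorm (∂_{a} (∂_{b} f) : 𝓢(V, ℂ)) 2 volume ≤ eLpNorm (Δ f : 𝓢(V, ℂ)) 2 volume := by
  rw [← eLpNorm_fourier_two, ← eLpNorm_fourier_two (Δ f)]
  refine eLpNorm_mono fun x => ?_
  rw [fourier_lineDerivOp_lineDerivOp_apply, fourier_laplacian_apply]
  simp only [norm_mul, norm_real]
  gcongr
  rw [norm_pow, norm_norm, pow_two]
  have hx : ∀ c : V, ‖c‖ ≤ 1 → ‖inner ℝ x c‖ ≤ ‖x‖ := fun c hc =>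
    (norm_inner_le_norm x c).trans (mul_le_of_le_one_right (norm_nonneg x) hc)
  gcongr
  exacts [hx a ha, hx b hb]

end SecondDerivatives

theorem norm_le_sum_norm_single {n : ℕ} {F : Type*} [NormedAddCommGroup F] [NormedSpace ℝ F]
    (L : EuclideanSpace ℝ (Fin n) →L[ℝ] F) :
    ‖L‖ ≤ ∑ i, ‖L (EuclideanSpace.single i 1)‖ := by
  refine L.opNorm_le_bound (by positivity) fun x => ?_
  conv_lhs => rw [← (EuclideanSpace.basisFun (Fin n) ℝ).sum_repr x]
  rw [map_sum, Finset.sum_mul]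
  refine (norm_sum_le _ _).trans (Finset.sum_le_sum fun i _ => ?_)
  rw [map_smul, norm_smul, mul_comm, EuclideanSpace.basisFun_apply,
    EuclideanSpace.basisFun_repr]
  gcongr
  exact PiLp.norm_apply_le x i

theorem eLpNorm_le_sum_eLpNorm {α ι G : Type*} [MeasurableSpace α] {μ : Measure α}
    [NormedAddCommGroup G] {H : ι → Type*} [∀ i, NormedAddCommGroup (H i)] {s : Finset ι}
    {p : ℝ≥0∞} (hp : 1 ≤ p) {g : α → G} {f : ∀ i, α → H i}
    (hf : ∀ i ∈ s, AEStronglyMeasurable (f i) μ) (h : ∀ x, ‖g x‖ ≤ ∑ i ∈ s, ‖f i x‖) :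
    eLpNorm g p μ ≤ ∑ i ∈ s, eLpNorm (f i) p μ := by
  have h1 : eLpNorm g p μ ≤ eLpNorm (∑ i ∈ s, fun x => ‖f i x‖) p μ :=
    eLpNorm_mono_real fun x => by simpa using h x
  refine (h1.trans (eLpNorm_sum_le (fun i hi => (hf i hi).norm) hp)).trans_eq ?_
  simp only [eLpNorm_norm]

theorem norm_gradNorm_le {n : ℕ} (φ : EuclideanSpace ℝ (Fin n) → ℂ)
    (x : EuclideanSpace ℝ (Fin n)) :
    ‖gradNorm φ x‖ ≤ ∑ i, ‖fderiv ℝ φ x (EuclideanSpace.single i 1)‖ := by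
  rw [gradNorm, Real.norm_of_nonneg (Real.sqrt_nonneg _)]
  exact Real.sqrt_le_iff.2
    ⟨by positivity, Finset.sum_sq_le_sq_sum_of_nonneg fun _ _ => norm_nonneg _⟩

theorem coe_laplacian_eq {n : ℕ} (φ : 𝓢(EuclideanSpace ℝ (Fin n), ℂ)) :
    ⇑(Δ φ : 𝓢(EuclideanSpace ℝ (Fin n), ℂ)) = laplacian φ := by
  ext x
  rw [SchwartzMap.laplacian_eq_sum (EuclideanSpace.basisFun (Fin n) ℝ), sum_apply]
  simp only [EuclideanSpace.basisFun_apply]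
  rfl

/-- For `n > 2` there is a constant `c > 0` such that for every Schwartz
function `φ : ℝⁿ → ℂ` one has `‖∇φ‖_{L^{2n/(n-2)}} ≤ c ‖Δφ‖_{L²}`, where `‖∇φ‖_{L^p}`
is the `L^p` norm of the Euclidean norm of the gradient of `φ`. -/
theorem sobolev_inequality_gradient (n : ℕ) (hn : 2 < n) :
    ∃ c : ℝ, 0 < c ∧
      ∀ φ : SchwartzMap (EuclideanSpace ℝ (Fin n)) ℂ,
        MeasureTheory.eLpNorm (gradNorm ⇑φ)
            (ENNReal.ofReal (2 * (n : ℝ) / ((n : ℝ) - 2))) MeasureTheory.volume ≤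
          ENNReal.ofReal c *
            MeasureTheory.eLpNorm (laplacian ⇑φ) 2 MeasureTheory.volume := by
  have hn' : (2 : ℝ) < n := by exact_mod_cast hn
  set p' : ℝ≥0 := (2 * (n : ℝ) / ((n : ℝ) - 2)).toNNReal with hp'
  have hp'c : (p' : ℝ) = 2 * (n : ℝ) / ((n : ℝ) - 2) :=
    Real.coe_toNNReal _ (div_nonneg (by positivity) (by linarith))
  have hp'1 : 1 ≤ p' := by
    rw [← NNReal.coe_le_coe, hp'c, NNReal.coe_one, one_le_div (by linarith)]
    linarith
  have hexp : (p' : ℝ)⁻¹ = ((2 : ℝ≥0) : ℝ)⁻¹ -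
      (finrank ℝ (EuclideanSpace ℝ (Fin n)) : ℝ)⁻¹ := by
    rw [hp'c, finrank_euclideanSpace_fin, NNReal.coe_ofNat]
    field_simp
  let e : Fin n → EuclideanSpace ℝ (Fin n) := fun i => EuclideanSpace.single i 1
  have he : ∀ i, ‖e i‖ ≤ 1 := fun i => by simp [e]
  let C : ℝ≥0 := SNormLESNormFDerivOfEqConst ℂ (volume : Measure (EuclideanSpace ℝ (Fin n))) 2
  refine ⟨n * (C * n) + 1, by positivity, fun φ => ?_⟩
  have hfderiv : ∀ i, eLpNorm (fderiv ℝ (∂_{e i} φ : 𝓢(EuclideanSpace ℝ (Fin n), ℂ))) 2 volume ≤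
      n * eLpNorm (laplacian φ) 2 volume := by
    intro i
    calc eLpNorm (fderiv ℝ (∂_{e i} φ : 𝓢(EuclideanSpace ℝ (Fin n), ℂ))) 2 volume
        ≤ ∑ j, eLpNorm (∂_{e j} (∂_{e i} φ) : 𝓢(EuclideanSpace ℝ (Fin n), ℂ)) 2 volume :=
          eLpNorm_le_sum_eLpNorm one_le_two
            (fun j _ => (SchwartzMap.continuous _).aestronglyMeasurable)
            (fun x => norm_le_sum_norm_single _)
      _ ≤ ∑ _j : Fin n, eLpNorm (laplacian φ) 2 volume := by
          rw [← coe_laplacian_eq]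
          exact Finset.sum_le_sum fun j _ => eLpNorm_lineDerivOp_lineDerivOp_le φ (he j) (he i)
      _ = _ := by simp
  have hgrad : eLpNorm (gradNorm φ) p' volume ≤
      n * (C * (n * eLpNorm (laplacian φ) 2 volume)) :=
    calc eLpNorm (gradNorm φ) p' volume
        ≤ ∑ i, eLpNorm (∂_{e i} φ : 𝓢(EuclideanSpace ℝ (Fin n), ℂ)) p' volume :=
          eLpNorm_le_sum_eLpNorm (mod_cast hp'1)
            (fun i _ => (SchwartzMap.continuous _).aestronglyMeasurable) (norm_gradNorm_le φ)
      _ ≤ ∑ _i : Fin n, C * (n * eLpNorm (laplacian φ) 2 volume) := by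
          refine Finset.sum_le_sum fun i _ => ?_
          refine (eLpNorm_le_eLpNorm_fderiv_of_memLp volume (p := 2) ((∂_{e i} φ).smooth 1)
            ((∂_{e i} φ).memLp 2 volume) one_le_two (by simp; lia) hexp).trans ?_
          exact mul_le_mul_right (hfderiv i) _
      _ = _ := by simp
  refine hgrad.trans ?_
  rw [← mul_assoc, ← mul_assoc, mul_assoc (n : ℝ≥0∞)]
  gcongr
  rw [ENNReal.ofReal_add (by positivity) zero_le_one, ENNReal.ofReal_mul (by positivity),
    ENNReal.ofReal_mul (by positivity), ENNReal.ofReal_natCast, ENNReal.ofReal_coe_nnreal]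
  exact le_self_add

end SingPert
end
end
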